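/- arXiv:1410.8738 — 2 statements merged into one kernel-verified Lean document; each statement's English description precedes it below -/
import Mathlib

section
/- With Λ² = a*a + b*b + 1 and X_0 = v·∂_x - ∂_x W·∂_v, the commutator satisfies [Λ², X_0] = -b*(Hess W - Id)a - a*(Hess W - Id)b on Schwartz functions. -/
/-- `∂_{x_j}` on functions of `(x,v) ∈ ℝ^d × ℝ^d`. -/
noncomputable def pdx {d : ℕ} (i : Fin d) (f : (Fin d → ℝ) × (Fin d → ℝ) → ℝ)
    (p : (Fin d → ℝ) × (Fin d → ℝ)) : ℝ := fderiv ℝ f p (Pi.single i 1, 0)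

/-- `∂_{v_j}` on functions of `(x,v) ∈ ℝ^d × ℝ^d`. -/
noncomputable def pdv {d : ℕ} (i : Fin d) (f : (Fin d → ℝ) × (Fin d → ℝ) → ℝ)
    (p : (Fin d → ℝ) × (Fin d → ℝ)) : ℝ := fderiv ℝ f p (0, Pi.single i 1)

/-- `∂_{x_i} W` for `W : ℝ^d → ℝ`. -/
noncomputable def pd {d : ℕ} (i : Fin d) (W : (Fin d → ℝ) → ℝ) (x : Fin d → ℝ) : ℝ :=
  fderiv ℝ W x (Pi.single i 1)

/-- `a_j = ∂_{x_j} + (∂_{x_j}W)/2`. -/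
noncomputable def aOp {d : ℕ} (W : (Fin d → ℝ) → ℝ) (j : Fin d)
    (f : (Fin d → ℝ) × (Fin d → ℝ) → ℝ) : (Fin d → ℝ) × (Fin d → ℝ) → ℝ :=
  fun p => pdx j f p + pd j W p.1 / 2 * f p

/-- `a_j* = -∂_{x_j} + (∂_{x_j}W)/2`. -/
noncomputable def aStar {d : ℕ} (W : (Fin d → ℝ) → ℝ) (j : Fin d)
    (f : (Fin d → ℝ) × (Fin d → ℝ) → ℝ) : (Fin d → ℝ) × (Fin d → ℝ) → ℝ :=
  fun p => -pdx j f p + pd j W p.1 / 2 * f p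

/-- `b_j = ∂_{v_j} + v_j/2`. -/
noncomputable def bOp {d : ℕ} (j : Fin d)
    (f : (Fin d → ℝ) × (Fin d → ℝ) → ℝ) : (Fin d → ℝ) × (Fin d → ℝ) → ℝ :=
  fun p => pdv j f p + p.2 j / 2 * f p

/-- `b_j* = -∂_{v_j} + v_j/2`. -/
noncomputable def bStar {d : ℕ} (j : Fin d)
    (f : (Fin d → ℝ) × (Fin d → ℝ) → ℝ) : (Fin d → ℝ) × (Fin d → ℝ) → ℝ :=
  fun p => -pdv j f p + p.2 j / 2 * f p

/-- The transport operator `X₀ = v·∂_x - ∂_x W·∂_v`. -/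
noncomputable def X0 {d : ℕ} (W : (Fin d → ℝ) → ℝ)
    (f : (Fin d → ℝ) × (Fin d → ℝ) → ℝ) : (Fin d → ℝ) × (Fin d → ℝ) → ℝ :=
  fun p => ∑ i, p.2 i * pdx i f p - ∑ i, pd i W p.1 * pdv i f p

/-- The Hessian entry `∂²_{x_j x_k} W`. -/
noncomputable def hess {d : ℕ} (W : (Fin d → ℝ) → ℝ) (j k : Fin d) (x : Fin d → ℝ) : ℝ :=
  fderiv ℝ (fun y => fderiv ℝ W y (Pi.single k 1)) x (Pi.single j 1)

/-- `Λ² = a*a + b*b + 1`. -/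
noncomputable def Lam2 {d : ℕ} (W : (Fin d → ℝ) → ℝ)
    (f : (Fin d → ℝ) × (Fin d → ℝ) → ℝ) : (Fin d → ℝ) × (Fin d → ℝ) → ℝ :=
  fun p => ∑ j, aStar W j (aOp W j f) p + ∑ j, bStar j (bOp j f) p + f p

section Smoothness

variable {E : Type*} [NormedAddCommGroup E] [NormedSpace ℝ E]

theorem contDiff_fderiv_apply {f : E → ℝ} {Y : E → E} (hf : ContDiff ℝ (⊤ : ℕ∞) f)
    (hY : ContDiff ℝ (⊤ : ℕ∞) Y) : ContDiff ℝ (⊤ : ℕ∞) (fun q => fderiv ℝ f q (Y q)) :=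
  (hf.fderiv_right (m := (⊤ : ℕ∞)) (by simp)).clm_apply hY

/-- The commutator of the first-order operator `∂_u + g` with the vector field `Y` is
`∂_{∂_u Y} - Y g`. -/
theorem fderiv_add_mul_comm_vectorField {f g : E → ℝ} {Y : E → E}
    (hf : ContDiff ℝ (⊤ : ℕ∞) f) (hg : ContDiff ℝ (⊤ : ℕ∞) g) (hY : ContDiff ℝ (⊤ : ℕ∞) Y)
    (u p : E) :
    fderiv ℝ (fun q => fderiv ℝ f q (Y q)) p u + g p * fderiv ℝ f p (Y p)
      = fderiv ℝ (fun q => fderiv ℝ f q u + g q * f q) p (Y p)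
        + fderiv ℝ f p (fderiv ℝ Y p u) - fderiv ℝ g p (Y p) * f p := by
  have hf' : DifferentiableAt ℝ (fderiv ℝ f) p :=
    ((hf.fderiv_right (m := (⊤ : ℕ∞)) (by simp)).differentiable (by simp)) p
  have hf0 : DifferentiableAt ℝ f p := hf.differentiable (by simp) p
  have hg0 : DifferentiableAt ℝ g p := hg.differentiable (by simp) p
  have hY0 : DifferentiableAt ℝ Y p := hY.differentiable (by simp) p
  have hsymm : fderiv ℝ (fderiv ℝ f) p u (Y p) = fderiv ℝ (fderiv ℝ f) p (Y p) u :=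
    (hf.contDiffAt.isSymmSndFDerivAt (by
      rw [minSmoothness_of_isRCLikeNormedField]
      exact WithTop.coe_le_coe.2 le_top)) u (Y p)
  rw [fderiv_fun_add (hf'.clm_apply (differentiableAt_const u)) (hg0.fun_mul hf0),
    fderiv_fun_mul hg0 hf0, fderiv_clm_apply hf' hY0,
    fderiv_clm_apply hf' (differentiableAt_const u)]
  simp [hsymm]
  ring

end Smoothness

section Kinetic

variable {d : ℕ} {W : (Fin d → ℝ) → ℝ} {f : (Fin d → ℝ) × (Fin d → ℝ) → ℝ}

/-- The Hamiltonian vector field `(v, -∂_x W)`, whose Lie derivative is `X0 W`. -/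
noncomputable def hamField (W : (Fin d → ℝ) → ℝ) (p : (Fin d → ℝ) × (Fin d → ℝ)) :
    (Fin d → ℝ) × (Fin d → ℝ) :=
  (p.2, fun i => -pd i W p.1)

theorem clm_apply_prod (L : (Fin d → ℝ) × (Fin d → ℝ) →L[ℝ] ℝ) (x v : Fin d → ℝ) :
    L (x, v) = ∑ i, x i * L (Pi.single i 1, 0) + ∑ i, v i * L (0, Pi.single i 1) := by
  have hx := LinearMap.pi_apply_eq_sum_univ
    (L.toLinearMap.comp (LinearMap.inl ℝ (Fin d → ℝ) (Fin d → ℝ))) x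
  have hv := LinearMap.pi_apply_eq_sum_univ
    (L.toLinearMap.comp (LinearMap.inr ℝ (Fin d → ℝ) (Fin d → ℝ))) v
  have hsingle (i : Fin d) : (fun j => if i = j then (1 : ℝ) else 0) = Pi.single i 1 := by
    ext j
    simp [Pi.single_apply, eq_comm]
  simp only [hsingle, LinearMap.comp_apply, LinearMap.inl_apply, LinearMap.inr_apply,
    ContinuousLinearMap.coe_coe, smul_eq_mul] at hx hv
  rw [← hx, ← hv, ← map_add]
  simp

theorem X0_eq_fderiv (W : (Fin d → ℝ) → ℝ) (f : (Fin d → ℝ) × (Fin d → ℝ) → ℝ) :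
    X0 W f = fun p => fderiv ℝ f p (hamField W p) := by
  ext p
  rw [hamField, clm_apply_prod]
  simp [X0, pdx, pdv, sub_eq_add_neg]

theorem contDiff_pd (hW : ContDiff ℝ (⊤ : ℕ∞) W) (i : Fin d) :
    ContDiff ℝ (⊤ : ℕ∞) (pd i W) :=
  contDiff_fderiv_apply hW contDiff_const

theorem contDiff_hess (hW : ContDiff ℝ (⊤ : ℕ∞) W) (j k : Fin d) :
    ContDiff ℝ (⊤ : ℕ∞) (hess W j k) :=
  contDiff_fderiv_apply (contDiff_pd hW k) contDiff_const

theorem contDiff_pd_fst (hW : ContDiff ℝ (⊤ : ℕ∞) W) (i : Fin d) :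
    ContDiff ℝ (⊤ : ℕ∞) (fun q : (Fin d → ℝ) × (Fin d → ℝ) => pd i W q.1) :=
  (contDiff_pd hW i).comp contDiff_fst

theorem contDiff_snd_apply (i : Fin d) :
    ContDiff ℝ (⊤ : ℕ∞) (fun q : (Fin d → ℝ) × (Fin d → ℝ) => q.2 i) :=
  (contDiff_apply ℝ ℝ i).comp contDiff_snd

theorem contDiff_hamField (hW : ContDiff ℝ (⊤ : ℕ∞) W) : ContDiff ℝ (⊤ : ℕ∞) (hamField W) :=
  contDiff_snd.prodMk (contDiff_pi.2 fun i => (contDiff_pd_fst hW i).neg)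

theorem contDiff_pdx (hf : ContDiff ℝ (⊤ : ℕ∞) f) (j : Fin d) :
    ContDiff ℝ (⊤ : ℕ∞) (pdx j f) :=
  contDiff_fderiv_apply hf contDiff_const

theorem contDiff_pdv (hf : ContDiff ℝ (⊤ : ℕ∞) f) (j : Fin d) :
    ContDiff ℝ (⊤ : ℕ∞) (pdv j f) :=
  contDiff_fderiv_apply hf contDiff_const

theorem contDiff_aOp (hW : ContDiff ℝ (⊤ : ℕ∞) W) (hf : ContDiff ℝ (⊤ : ℕ∞) f) (j : Fin d) :
    ContDiff ℝ (⊤ : ℕ∞) (aOp W j f) :=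
  (contDiff_pdx hf j).add (((contDiff_pd_fst hW j).div_const 2).mul hf)

theorem contDiff_aStar (hW : ContDiff ℝ (⊤ : ℕ∞) W) (hf : ContDiff ℝ (⊤ : ℕ∞) f) (j : Fin d) :
    ContDiff ℝ (⊤ : ℕ∞) (aStar W j f) :=
  (contDiff_pdx hf j).neg.add (((contDiff_pd_fst hW j).div_const 2).mul hf)

theorem contDiff_bOp (hf : ContDiff ℝ (⊤ : ℕ∞) f) (j : Fin d) :
    ContDiff ℝ (⊤ : ℕ∞) (bOp j f) :=
  (contDiff_pdv hf j).add (((contDiff_snd_apply j).div_const 2).mul hf)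

theorem contDiff_bStar (hf : ContDiff ℝ (⊤ : ℕ∞) f) (j : Fin d) :
    ContDiff ℝ (⊤ : ℕ∞) (bStar j f) :=
  (contDiff_pdv hf j).neg.add (((contDiff_snd_apply j).div_const 2).mul hf)

theorem contDiff_X0 (hW : ContDiff ℝ (⊤ : ℕ∞) W) (hf : ContDiff ℝ (⊤ : ℕ∞) f) :
    ContDiff ℝ (⊤ : ℕ∞) (X0 W f) := by
  rw [X0_eq_fderiv]
  exact contDiff_fderiv_apply hf (contDiff_hamField hW)

theorem fderiv_pd_single (W : (Fin d → ℝ) → ℝ) (i j : Fin d) (x : Fin d → ℝ) :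
    fderiv ℝ (pd i W) x (Pi.single j 1) = hess W j i x :=
  rfl

theorem hess_symm (hW : ContDiff ℝ (⊤ : ℕ∞) W) (j k : Fin d) (x : Fin d → ℝ) :
    hess W j k x = hess W k j x := by
  have hW' : DifferentiableAt ℝ (fderiv ℝ W) x :=
    ((hW.fderiv_right (m := (⊤ : ℕ∞)) (by simp)).differentiable (by simp)) x
  have hsymm := (hW.contDiffAt (x := x)).isSymmSndFDerivAt (by
      rw [minSmoothness_of_isRCLikeNormedField]
      exact WithTop.coe_le_coe.2 le_top)
    (Pi.single j 1) (Pi.single k 1)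
  rw [hess, hess, fderiv_clm_apply hW' (differentiableAt_const _),
    fderiv_clm_apply hW' (differentiableAt_const _)]
  simpa using hsymm

theorem fderiv_pd_fst (hW : ContDiff ℝ (⊤ : ℕ∞) W) (i : Fin d)
    (p u : (Fin d → ℝ) × (Fin d → ℝ)) :
    fderiv ℝ (fun q : (Fin d → ℝ) × (Fin d → ℝ) => pd i W q.1) p u
      = fderiv ℝ (pd i W) p.1 u.1 := by
  have h : DifferentiableAt ℝ (pd i W) p.1 := (contDiff_pd hW i).differentiable (by simp) p.1
  have := (h.hasFDerivAt.comp p hasFDerivAt_fst).fderiv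
  simp only [Function.comp_def] at this
  rw [this]
  rfl

theorem fderiv_snd_apply (i : Fin d) (p u : (Fin d → ℝ) × (Fin d → ℝ)) :
    fderiv ℝ (fun q : (Fin d → ℝ) × (Fin d → ℝ) => q.2 i) p u = u.2 i :=
  congrArg (fun L => L u) (((ContinuousLinearMap.proj (R := ℝ) (φ := fun _ : Fin d => ℝ) i).comp
    (ContinuousLinearMap.snd ℝ (Fin d → ℝ) (Fin d → ℝ))).fderiv (x := p))

theorem fderiv_hamField (hW : ContDiff ℝ (⊤ : ℕ∞) W) (p u : (Fin d → ℝ) × (Fin d → ℝ)) :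
    fderiv ℝ (hamField W) p u = (u.2, fun i => -fderiv ℝ (pd i W) p.1 u.1) := by
  have hdiff (i : Fin d) :
      DifferentiableAt ℝ (fun q : (Fin d → ℝ) × (Fin d → ℝ) => pd i W q.1) p :=
    (contDiff_pd_fst hW i).differentiable (by simp) p
  have h : HasFDerivAt (hamField W) _ p :=
    hasFDerivAt_snd.prodMk (hasFDerivAt_pi.2 fun i => (hdiff i).hasFDerivAt.neg)
  rw [h.fderiv]
  ext i
  · simp
  · simp [fderiv_pd_fst hW]

theorem fderiv_pd_fst_hamField (hW : ContDiff ℝ (⊤ : ℕ∞) W) (j : Fin d)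
    (p : (Fin d → ℝ) × (Fin d → ℝ)) :
    fderiv ℝ (fun q : (Fin d → ℝ) × (Fin d → ℝ) => pd j W q.1 / 2) p (hamField W p)
      = ∑ i, hess W j i p.1 * (p.2 i / 2) := by
  have hdiff : DifferentiableAt ℝ (fun q : (Fin d → ℝ) × (Fin d → ℝ) => pd j W q.1) p :=
    (contDiff_pd_fst hW j).differentiable (by simp) p
  simp only [div_eq_mul_inv]
  rw [fderiv_mul_const hdiff]
  have h := clm_apply_prod (fderiv ℝ (fun q : (Fin d → ℝ) × (Fin d → ℝ) => pd j W q.1) p)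
    p.2 (fun i => -pd i W p.1)
  simp only [fderiv_pd_fst hW, map_zero, mul_zero, Finset.sum_const_zero, add_zero] at h
  simp only [smul_apply, smul_eq_mul, hamField, fderiv_pd_fst hW, h,
    Finset.mul_sum]
  refine Finset.sum_congr rfl fun i _ => ?_
  rw [hess_symm hW j i, fderiv_pd_single]
  ring

theorem fderiv_snd_apply_hamField (j : Fin d) (p : (Fin d → ℝ) × (Fin d → ℝ)) :
    fderiv ℝ (fun q : (Fin d → ℝ) × (Fin d → ℝ) => q.2 j / 2) p (hamField W p)
      = -(pd j W p.1 / 2) := by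
  have hdiff : DifferentiableAt ℝ (fun q : (Fin d → ℝ) × (Fin d → ℝ) => q.2 j) p :=
    (contDiff_snd_apply j).differentiable (by simp) p
  simp only [div_eq_mul_inv]
  rw [fderiv_mul_const hdiff]
  simp [fderiv_snd_apply, hamField]
  ring

theorem aOp_X0 (hW : ContDiff ℝ (⊤ : ℕ∞) W) (hf : ContDiff ℝ (⊤ : ℕ∞) f) (j : Fin d)
    (p : (Fin d → ℝ) × (Fin d → ℝ)) :
    aOp W j (X0 W f) p = X0 W (aOp W j f) p - ∑ i, hess W j i p.1 * bOp i f p := by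
  have h := fderiv_add_mul_comm_vectorField hf ((contDiff_pd_fst hW j).div_const 2)
    (contDiff_hamField hW) (Pi.single j 1, 0) p
  rw [fderiv_pd_fst_hamField hW, fderiv_hamField hW, clm_apply_prod (fderiv ℝ f p) (0 : Fin d → ℝ)] at h
  simp only [X0_eq_fderiv]
  refine h.trans ?_
  simp only [bOp, mul_add, Finset.sum_add_distrib, Finset.sum_mul, fderiv_pd_single, pdv,
    Pi.zero_apply, zero_mul, Finset.sum_const_zero, zero_add, neg_mul, Finset.sum_neg_distrib, mul_assoc]
  change fderiv ℝ (aOp W j f) p _ + _ - _ = _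
  ring

theorem aStar_X0 (hW : ContDiff ℝ (⊤ : ℕ∞) W) (hf : ContDiff ℝ (⊤ : ℕ∞) f) (j : Fin d)
    (p : (Fin d → ℝ) × (Fin d → ℝ)) :
    aStar W j (X0 W f) p = X0 W (aStar W j f) p - ∑ i, hess W j i p.1 * bStar i f p := by
  have h := fderiv_add_mul_comm_vectorField hf ((contDiff_pd_fst hW j).div_const 2)
    (contDiff_hamField hW) (-(Pi.single j 1, 0)) p
  rw [fderiv_pd_fst_hamField hW, map_neg (fderiv ℝ (hamField W) p), fderiv_hamField hW,
    map_neg (fderiv ℝ f p), clm_apply_prod (fderiv ℝ f p) (0 : Fin d → ℝ)] at h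
  simp only [map_neg] at h
  simp only [X0_eq_fderiv]
  refine h.trans ?_
  simp only [bStar, mul_add, Finset.sum_add_distrib, Finset.sum_mul, fderiv_pd_single, pdv,
    Pi.zero_apply, zero_mul, Finset.sum_const_zero, zero_add, neg_mul, mul_neg, Finset.sum_neg_distrib, mul_assoc]
  change fderiv ℝ (aStar W j f) p _ + _ - _ = _
  ring

theorem bOp_X0 (hW : ContDiff ℝ (⊤ : ℕ∞) W) (hf : ContDiff ℝ (⊤ : ℕ∞) f) (j : Fin d)
    (p : (Fin d → ℝ) × (Fin d → ℝ)) :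
    bOp j (X0 W f) p = X0 W (bOp j f) p + aOp W j f p := by
  have h := fderiv_add_mul_comm_vectorField hf ((contDiff_snd_apply j).div_const 2)
    (contDiff_hamField hW) (0, Pi.single j 1) p
  rw [fderiv_snd_apply_hamField, fderiv_hamField hW] at h
  simp only [map_zero, neg_zero] at h
  simp only [X0_eq_fderiv]
  refine h.trans ?_
  change fderiv ℝ (bOp j f) p _ + pdx j f p - _ = _
  simp only [aOp]
  ring

theorem bStar_X0 (hW : ContDiff ℝ (⊤ : ℕ∞) W) (hf : ContDiff ℝ (⊤ : ℕ∞) f) (j : Fin d)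
    (p : (Fin d → ℝ) × (Fin d → ℝ)) :
    bStar j (X0 W f) p = X0 W (bStar j f) p + aStar W j f p := by
  have h := fderiv_add_mul_comm_vectorField hf ((contDiff_snd_apply j).div_const 2)
    (contDiff_hamField hW) (-(0, Pi.single j 1)) p
  rw [fderiv_snd_apply_hamField, map_neg (fderiv ℝ (hamField W) p), fderiv_hamField hW,
    map_neg (fderiv ℝ f p)] at h
  simp only [map_neg, map_zero, neg_zero] at h
  simp only [X0_eq_fderiv]
  refine h.trans ?_
  change fderiv ℝ (bStar j f) p _ + -pdx j f p - _ = _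
  simp only [aStar]
  ring

variable {g : (Fin d → ℝ) × (Fin d → ℝ) → ℝ}

theorem X0_add (W : (Fin d → ℝ) → ℝ) (hf : Differentiable ℝ f) (hg : Differentiable ℝ g)
    (p : (Fin d → ℝ) × (Fin d → ℝ)) :
    X0 W (fun q => f q + g q) p = X0 W f p + X0 W g p := by
  simp only [X0_eq_fderiv]
  rw [fderiv_fun_add (hf p) (hg p)]
  rfl

theorem X0_sum (W : (Fin d → ℝ) → ℝ) {F : Fin d → (Fin d → ℝ) × (Fin d → ℝ) → ℝ}
    (hF : ∀ j, Differentiable ℝ (F j)) (p : (Fin d → ℝ) × (Fin d → ℝ)) :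
    X0 W (fun q => ∑ j, F j q) p = ∑ j, X0 W (F j) p := by
  simp only [X0_eq_fderiv]
  rw [fderiv_fun_sum fun j _ => hF j p]
  simp

theorem aStar_sub (W : (Fin d → ℝ) → ℝ) (hf : Differentiable ℝ f) (hg : Differentiable ℝ g)
    (j : Fin d) (p : (Fin d → ℝ) × (Fin d → ℝ)) :
    aStar W j (fun q => f q - g q) p = aStar W j f p - aStar W j g p := by
  simp only [aStar, pdx]
  rw [fderiv_fun_sub (hf p) (hg p), sub_apply]
  ring

theorem bStar_add (hf : Differentiable ℝ f) (hg : Differentiable ℝ g)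
    (j : Fin d) (p : (Fin d → ℝ) × (Fin d → ℝ)) :
    bStar j (fun q => f q + g q) p = bStar j f p + bStar j g p := by
  simp only [bStar, pdv]
  rw [fderiv_fun_add (hf p) (hg p), add_apply]
  ring

/-- `b_j*` differentiates in `v` only, so it commutes with multiplication by functions of `x`. -/
theorem bStar_sum_mul_fst {c : Fin d → (Fin d → ℝ) → ℝ}
    {F : Fin d → (Fin d → ℝ) × (Fin d → ℝ) → ℝ} (hc : ∀ k, Differentiable ℝ (c k))
    (hF : ∀ k, Differentiable ℝ (F k)) (j : Fin d) (p : (Fin d → ℝ) × (Fin d → ℝ)) :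
    bStar j (fun q => ∑ k, c k q.1 * F k q) p = ∑ k, c k p.1 * bStar j (F k) p := by
  have hck (k : Fin d) :
      HasFDerivAt (fun q : (Fin d → ℝ) × (Fin d → ℝ) => c k q.1) _ p :=
    (hc k p.1).hasFDerivAt.comp p hasFDerivAt_fst
  have hsum := HasFDerivAt.fun_sum (u := Finset.univ)
    fun k _ => (hck k).fun_mul (hF k p).hasFDerivAt
  have hpdv : pdv j (fun q => ∑ k, c k q.1 * F k q) p = ∑ k, c k p.1 * pdv j (F k) p := by
    rw [pdv, hsum.fderiv]
    simp [pdv]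
  simp only [bStar, hpdv, mul_add, Finset.sum_add_distrib, Finset.mul_sum, mul_neg,
    Finset.sum_neg_distrib]
  congr 1
  exact Finset.sum_congr rfl fun k _ => by ring

theorem X0_Lam2 (hW : ContDiff ℝ (⊤ : ℕ∞) W) (hf : ContDiff ℝ (⊤ : ℕ∞) f)
    (p : (Fin d → ℝ) × (Fin d → ℝ)) :
    X0 W (Lam2 W f) p
      = ∑ j, X0 W (aStar W j (aOp W j f)) p + ∑ j, X0 W (bStar j (bOp j f)) p + X0 W f p := by
  have ha (j : Fin d) : Differentiable ℝ (aStar W j (aOp W j f)) :=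
    (contDiff_aStar hW (contDiff_aOp hW hf j) j).differentiable (by simp)
  have hb (j : Fin d) : Differentiable ℝ (bStar j (bOp j f)) :=
    (contDiff_bStar (contDiff_bOp hf j) j).differentiable (by simp)
  have ha' : Differentiable ℝ (fun q => ∑ j, aStar W j (aOp W j f) q) :=
    Differentiable.fun_sum fun j _ => ha j
  have hb' : Differentiable ℝ (fun q => ∑ j, bStar j (bOp j f) q) :=
    Differentiable.fun_sum fun j _ => hb j
  rw [← X0_sum W ha, ← X0_sum W hb, ← X0_add W ha' hb',
    ← X0_add W (ha'.fun_add hb') (hf.differentiable (by simp))]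
  rfl

theorem aStar_aOp_X0 (hW : ContDiff ℝ (⊤ : ℕ∞) W) (hf : ContDiff ℝ (⊤ : ℕ∞) f) (j : Fin d)
    (p : (Fin d → ℝ) × (Fin d → ℝ)) :
    aStar W j (aOp W j (X0 W f)) p = X0 W (aStar W j (aOp W j f)) p
      - ∑ i, hess W j i p.1 * bStar i (aOp W j f) p
      - aStar W j (fun q => ∑ i, hess W j i q.1 * bOp i f q) p := by
  have hsum : ContDiff ℝ (⊤ : ℕ∞) (fun q : (Fin d → ℝ) × (Fin d → ℝ) =>
      ∑ i, hess W j i q.1 * bOp i f q) :=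
    ContDiff.sum fun i _ => ((contDiff_hess hW j i).comp contDiff_fst).mul (contDiff_bOp hf i)
  rw [funext (aOp_X0 hW hf j),
    aStar_sub W ((contDiff_X0 hW (contDiff_aOp hW hf j)).differentiable (by simp))
      (hsum.differentiable (by simp)),
    aStar_X0 hW (contDiff_aOp hW hf j)]

theorem bStar_bOp_X0 (hW : ContDiff ℝ (⊤ : ℕ∞) W) (hf : ContDiff ℝ (⊤ : ℕ∞) f) (j : Fin d)
    (p : (Fin d → ℝ) × (Fin d → ℝ)) :
    bStar j (bOp j (X0 W f)) p = X0 W (bStar j (bOp j f)) p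
      + aStar W j (bOp j f) p + bStar j (aOp W j f) p := by
  rw [funext (bOp_X0 hW hf j),
    bStar_add ((contDiff_X0 hW (contDiff_bOp hf j)).differentiable (by simp))
      ((contDiff_aOp hW hf j).differentiable (by simp)),
    bStar_X0 hW (contDiff_bOp hf j)]

end Kinetic

/-- The commutator identity `[Λ², X₀] = -b*(Hess W - Id)a - a*(Hess W - Id)b`. -/
theorem stmt_9 {d : ℕ} (W : (Fin d → ℝ) → ℝ) (hW : ContDiff ℝ (⊤ : ℕ∞) W)
    (f : (Fin d → ℝ) × (Fin d → ℝ) → ℝ) (hf : ContDiff ℝ (⊤ : ℕ∞) f) :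
    ∀ p : (Fin d → ℝ) × (Fin d → ℝ),
      Lam2 W (X0 W f) p - X0 W (Lam2 W f) p
        = -(∑ j, bStar j
              (fun q => ∑ k, (hess W j k q.1 - if j = k then 1 else 0) * aOp W k f q) p)
          - ∑ j, aStar W j
              (fun q => ∑ k, (hess W j k q.1 - if j = k then 1 else 0) * bOp k f q) p := by
  intro p
  have hb (j : Fin d) : bStar j
      (fun q => ∑ k, (hess W j k q.1 - if j = k then 1 else 0) * aOp W k f q) p
      = ∑ k, hess W j k p.1 * bStar j (aOp W k f) p - bStar j (aOp W j f) p := by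
    rw [bStar_sum_mul_fst (c := fun k x => hess W j k x - if j = k then 1 else 0)
      (fun k => ((contDiff_hess hW j k).differentiable (by simp)).sub_const _)
      (fun k => (contDiff_aOp hW hf k).differentiable (by simp))]
    simp [sub_mul]
  have ha (j : Fin d) : aStar W j
      (fun q => ∑ k, (hess W j k q.1 - if j = k then 1 else 0) * bOp k f q) p
      = aStar W j (fun q => ∑ k, hess W j k q.1 * bOp k f q) p - aStar W j (bOp j f) p := by
    have hsum : ContDiff ℝ (⊤ : ℕ∞) (fun q : (Fin d → ℝ) × (Fin d → ℝ) =>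
        ∑ i, hess W j i q.1 * bOp i f q) :=
      ContDiff.sum fun i _ => ((contDiff_hess hW j i).comp contDiff_fst).mul (contDiff_bOp hf i)
    rw [← aStar_sub W (hsum.differentiable (by simp))
      ((contDiff_bOp hf j).differentiable (by simp))]
    simp [sub_mul]
  have hswap : ∑ j, ∑ k, hess W j k p.1 * bStar k (aOp W j f) p
      = ∑ j, ∑ k, hess W j k p.1 * bStar j (aOp W k f) p := by
    rw [Finset.sum_comm]
    exact Finset.sum_congr rfl fun j _ => Finset.sum_congr rfl fun k _ => by
      rw [hess_symm hW]
  rw [X0_Lam2 hW hf]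
  simp only [Lam2, aStar_aOp_X0 hW hf, bStar_bOp_X0 hW hf, ha, hb, Finset.sum_add_distrib,
    Finset.sum_sub_distrib, hswap]
  ring
end

section
/- For Schwartz u on ℝ^{2d}, ‖a_j* b_k Λ^{-2} u‖² ≤ (‖Hess W‖_{L^∞} + 2)‖u‖², using [Λ², b_k] = -b_k, a_j a_j* = a_j* a_j + ∂²_j W, and b_k* b_k ≤ Λ², 1 ≤ Λ². -/
open MeasureTheory

open scoped SchwartzMap LineDeriv ContDiff

section FirstOrderOperators

variable {E : Type*} [NormedAddCommGroup E] [NormedSpace ℝ E]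

/-- The first-order operator `∂_e + g` on real Schwartz functions. -/
noncomputable def firstOrderOp (e : E) (g : E → ℝ) : 𝓢(E, ℝ) →ₗ[ℝ] 𝓢(E, ℝ) :=
  (LineDeriv.lineDerivOpCLM ℝ 𝓢(E, ℝ) e + SchwartzMap.smulLeftCLM ℝ g).toLinearMap

theorem firstOrderOp_eq (e : E) (g : E → ℝ) (f : 𝓢(E, ℝ)) :
    firstOrderOp e g f = ∂_{e} f + SchwartzMap.smulLeftCLM ℝ g f := by
  simp [firstOrderOp]

theorem firstOrderOp_apply {g : E → ℝ} (hg : g.HasTemperateGrowth) (e : E) (f : 𝓢(E, ℝ)) (x : E) :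
    firstOrderOp e g f x = fderiv ℝ f x e + g x * f x := by
  simp [firstOrderOp_eq, SchwartzMap.smulLeftCLM_apply_apply hg,
    SchwartzMap.lineDerivOp_apply_eq_fderiv]

theorem fderiv_firstOrderOp {g : E → ℝ} (hg : g.HasTemperateGrowth) (e e' : E) (f : 𝓢(E, ℝ))
    (x : E) : fderiv ℝ (firstOrderOp e g f) x e' =
      fderiv ℝ (fderiv ℝ f) x e' e + (g x * fderiv ℝ f x e' + f x * fderiv ℝ g x e') := by
  have hfun : (firstOrderOp e g f : E → ℝ) = fun y => fderiv ℝ f y e + g y * f y :=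
    funext (firstOrderOp_apply hg e f)
  have hf' : DifferentiableAt ℝ (fderiv ℝ f) x :=
    ((f.smooth 2).fderiv_right (m := 1) (by norm_num)).differentiable (by norm_num) x
  have hg' : DifferentiableAt ℝ g x := hg.1.differentiable (by simp) x
  rw [hfun, fderiv_fun_add (hf'.clm_apply (differentiableAt_const e))
    (hg'.fun_mul f.differentiableAt), fderiv_fun_mul hg' f.differentiableAt,
    fderiv_clm_apply hf' (differentiableAt_const e)]
  simp

/-- The commutator of two first-order operators is a multiplication operator. -/
theorem firstOrderOp_commutator {g g' : E → ℝ} (hg : g.HasTemperateGrowth)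
    (hg' : g'.HasTemperateGrowth) (e e' : E) (f : 𝓢(E, ℝ)) (x : E) :
    firstOrderOp e g (firstOrderOp e' g' f) x = firstOrderOp e' g' (firstOrderOp e g f) x
      + (fderiv ℝ g' x e - fderiv ℝ g x e') * f x := by
  have hsymm : IsSymmSndFDerivAt ℝ f x :=
    (f.smooth 2).contDiffAt.isSymmSndFDerivAt (by simp)
  simp only [firstOrderOp_apply hg, firstOrderOp_apply hg', fderiv_firstOrderOp hg,
    fderiv_firstOrderOp hg']
  rw [hsymm.eq e e']
  ring

theorem mul_firstOrderOp_commutator_neg {g : E → ℝ} (hg : g.HasTemperateGrowth) (e : E)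
    (f : 𝓢(E, ℝ)) (x : E) :
    f x * firstOrderOp e g (firstOrderOp (-e) g f) x
      = f x * firstOrderOp (-e) g (firstOrderOp e g f) x + 2 * fderiv ℝ g x e * (f x * f x) := by
  rw [firstOrderOp_commutator hg hg, map_neg]
  ring

variable [MeasureSpace E] [BorelSpace E] [FiniteDimensional ℝ E]
  [(volume : Measure E).IsAddHaarMeasure]

theorem SchwartzMap.integrable_mul (f g : 𝓢(E, ℝ)) : Integrable (fun x => f x * g x) :=
  (f.memLp 2).integrable_mul (g.memLp 2)

/-- The formal adjoint of `∂_e + g` is `-∂_e + g`. -/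
theorem integral_firstOrderOp_mul {g : E → ℝ} (hg : g.HasTemperateGrowth) (e : E)
    (f h : 𝓢(E, ℝ)) :
    ∫ x, firstOrderOp e g f x * h x = ∫ x, f x * firstOrderOp (-e) g h x := by
  have hpart := SchwartzMap.integral_mul_lineDerivOp_right_eq_neg_left (μ := volume) f h e
  have hleft : ∀ x, firstOrderOp e g f x * h x
      = (∂_{e} f) x * h x + f x * SchwartzMap.smulLeftCLM ℝ g h x := fun x => by
    simp [firstOrderOp_eq, SchwartzMap.smulLeftCLM_apply_apply hg]; ring
  have hright : ∀ x, f x * firstOrderOp (-e) g h x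
      = f x * SchwartzMap.smulLeftCLM ℝ g h x - f x * (∂_{e} h) x := fun x => by
    simp [firstOrderOp_eq, SchwartzMap.lineDerivOp_apply_eq_fderiv]; ring
  simp_rw [hleft, hright]
  rw [integral_add (SchwartzMap.integrable_mul _ _) (SchwartzMap.integrable_mul _ _),
    integral_sub (SchwartzMap.integrable_mul _ _) (SchwartzMap.integrable_mul _ _), hpart]
  ring

theorem integral_firstOrderOp_neg_mul {g : E → ℝ} (hg : g.HasTemperateGrowth) (e : E)
    (f h : 𝓢(E, ℝ)) :
    ∫ x, firstOrderOp (-e) g f x * h x = ∫ x, f x * firstOrderOp e g h x := by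
  simpa using integral_firstOrderOp_mul hg (-e) f h

theorem integrable_fderiv_mul_sq {g : E → ℝ} (hg : g.HasTemperateGrowth) (e : E) (f : 𝓢(E, ℝ)) :
    Integrable (fun x => 2 * fderiv ℝ g x e * (f x * f x)) := by
  refine ((SchwartzMap.integrable_mul f (firstOrderOp e g (firstOrderOp (-e) g f))).sub
    (SchwartzMap.integrable_mul f (firstOrderOp (-e) g (firstOrderOp e g f)))).congr
    (.of_forall fun x => ?_)
  simp [mul_firstOrderOp_commutator_neg hg e f x]

/-- `‖(∂_e + g)* f‖² = ‖(∂_e + g) f‖² + ⟨2 (∂_e g) f, f⟩`. -/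
theorem integral_firstOrderOp_neg_sq {g : E → ℝ} (hg : g.HasTemperateGrowth) (e : E)
    (f : 𝓢(E, ℝ)) :
    ∫ x, firstOrderOp (-e) g f x * firstOrderOp (-e) g f x
      = (∫ x, firstOrderOp e g f x * firstOrderOp e g f x)
        + ∫ x, 2 * fderiv ℝ g x e * (f x * f x) := by
  rw [integral_firstOrderOp_neg_mul hg, integral_firstOrderOp_mul hg, ← integral_add
    (SchwartzMap.integrable_mul _ _) (integrable_fderiv_mul_sq hg e f)]
  exact integral_congr_ae (.of_forall (mul_firstOrderOp_commutator_neg hg e f))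

theorem SchwartzMap.eLpNorm_two_sq (f : 𝓢(E, ℝ)) :
    eLpNorm f 2 volume ^ 2 = ENNReal.ofReal (∫ x, f x * f x) := by
  rw [(f.memLp 2 volume).eLpNorm_eq_integral_rpow_norm (by norm_num) (by norm_num),
    ← ENNReal.ofReal_pow (by positivity), ← Real.rpow_natCast, ← Real.rpow_mul (by positivity)]
  simp [← pow_two]

end FirstOrderOperators

section TemperateGrowth

variable {E F : Type*} [NormedAddCommGroup E] [NormedSpace ℝ E] [NormedAddCommGroup F]
  [NormedSpace ℝ F]

/-- A smooth function whose derivatives of order at least two are bounded has a derivative of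
temperate growth. -/
theorem hasTemperateGrowth_fderiv_of_bounded {W : E → F} (hW : ContDiff ℝ ∞ W)
    (hbd : ∀ n : ℕ, 2 ≤ n → ∃ C : ℝ, ∀ x, ‖iteratedFDeriv ℝ n W x‖ ≤ C) :
    (fderiv ℝ W).HasTemperateGrowth := by
  have hW' : ContDiff ℝ ∞ (fderiv ℝ W) := hW.fderiv_right (by simp)
  have hdiff : Differentiable ℝ (fderiv ℝ W) := hW'.differentiable (by simp)
  have hbound : ∀ n : ℕ, ∃ C : ℝ, ∀ x, ‖iteratedFDeriv ℝ n (fderiv ℝ (fderiv ℝ W)) x‖ ≤ C := by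
    intro n
    obtain ⟨C, hC⟩ := hbd (n + 2) (by omega)
    refine ⟨C, fun x => ?_⟩
    rw [norm_iteratedFDeriv_fderiv, norm_iteratedFDeriv_fderiv]
    exact hC x
  obtain ⟨C, hC⟩ := hbound 0
  have hC' : ∀ x, ‖fderiv ℝ (fderiv ℝ W) x‖ ≤ C := fun x => by simpa using hC x
  have hC0 : 0 ≤ C := (norm_nonneg (fderiv ℝ (fderiv ℝ W) 0)).trans (hC' 0)
  refine .of_fderiv ⟨hW'.fderiv_right (by simp), fun n => ?_⟩ hdiff
    (k := 1) (C := C + ‖fderiv ℝ W 0‖) fun x => ?_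
  · obtain ⟨C, hC⟩ := hbound n
    exact ⟨0, C, by simpa using hC⟩
  · have hmv := convex_univ.norm_image_sub_le_of_norm_fderiv_le (𝕜 := ℝ)
      (fun y _ => hdiff y) (fun y _ => hC' y) (Set.mem_univ 0) (Set.mem_univ x)
    have htri := norm_le_norm_add_norm_sub' (fderiv ℝ W x) (fderiv ℝ W 0)
    rw [sub_zero] at hmv
    nlinarith [norm_nonneg x, norm_nonneg (fderiv ℝ W 0),
      mul_nonneg (norm_nonneg x) (norm_nonneg (fderiv ℝ W 0))]

end TemperateGrowth

section PhaseSpace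

variable {d : ℕ}

local notation "Phase" => (Fin d → ℝ) × (Fin d → ℝ)

instance isAddHaarMeasure_volume_phase : (volume : Measure Phase).IsAddHaarMeasure :=
  Measure.prod.instIsAddHaarMeasure (volume : Measure (Fin d → ℝ)) volume

theorem hasTemperateGrowth_pd {W : (Fin d → ℝ) → ℝ} (hW : (fderiv ℝ W).HasTemperateGrowth)
    (j : Fin d) : (fun p : Phase => pd j W p.1 / 2).HasTemperateGrowth := by
  have hcomp := (((1 / 2 : ℝ) • ContinuousLinearMap.apply ℝ ℝ
    (Pi.single j 1 : Fin d → ℝ)).hasTemperateGrowth.comp hW).comp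
    (ContinuousLinearMap.fst ℝ (Fin d → ℝ) (Fin d → ℝ)).hasTemperateGrowth
  convert hcomp using 1
  ext p
  simp [pd]
  ring

theorem hasTemperateGrowth_velocity (k : Fin d) :
    (fun p : Phase => p.2 k / 2).HasTemperateGrowth := by
  convert ((1 / 2 : ℝ) • (ContinuousLinearMap.proj (R := ℝ) (φ := fun _ : Fin d => ℝ) k).comp
    (ContinuousLinearMap.snd ℝ (Fin d → ℝ) (Fin d → ℝ))).hasTemperateGrowth using 1
  ext p
  simp
  ring

theorem fderiv_velocity (k : Fin d) (p e : Phase) :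
    fderiv ℝ (fun p : Phase => p.2 k / 2) p e = e.2 k / 2 := by
  have hlin : (fun p : Phase => p.2 k / 2) = ⇑((1 / 2 : ℝ) •
      (ContinuousLinearMap.proj (R := ℝ) (φ := fun _ : Fin d => ℝ) k).comp
        (ContinuousLinearMap.snd ℝ (Fin d → ℝ) (Fin d → ℝ))) := by
    ext p
    simp
    ring
  rw [hlin, ContinuousLinearMap.fderiv]
  simp
  ring

theorem fderiv_pd {W : (Fin d → ℝ) → ℝ} (hW : Differentiable ℝ (fderiv ℝ W)) (j : Fin d)
    (p e : Phase) : fderiv ℝ (fun p : Phase => pd j W p.1 / 2) p e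
      = fderiv ℝ (fderiv ℝ W) p.1 e.1 (Pi.single j 1) / 2 := by
  have hd : HasFDerivAt (fun p : Phase => fderiv ℝ W p.1 (Pi.single j 1))
      ((ContinuousLinearMap.apply ℝ ℝ (Pi.single j 1 : Fin d → ℝ)).comp
        ((fderiv ℝ (fderiv ℝ W) p.1).comp (ContinuousLinearMap.fst ℝ _ _))) p :=
    (ContinuousLinearMap.apply ℝ ℝ (Pi.single j 1 : Fin d → ℝ)).hasFDerivAt.comp p
      ((hW p.1).hasFDerivAt.comp p hasFDerivAt_fst)
  have hd' := hd.mul_const (1 / 2 : ℝ)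
  have hfun : (fun p : Phase => pd j W p.1 / 2)
      = fun p : Phase => fderiv ℝ W p.1 (Pi.single j 1) * (1 / 2) := by
    ext p
    simp [pd]
    ring
  rw [hfun, hd'.fderiv]
  simp
  ring

/-- `a_j` as an operator on Schwartz functions. -/
noncomputable def schwartzA (W : (Fin d → ℝ) → ℝ) (j : Fin d) : 𝓢(Phase, ℝ) →ₗ[ℝ] 𝓢(Phase, ℝ) :=
  firstOrderOp (Pi.single j 1, 0) fun p => pd j W p.1 / 2

/-- `a_j*` as an operator on Schwartz functions. -/
noncomputable def schwartzAStar (W : (Fin d → ℝ) → ℝ) (j : Fin d) :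
    𝓢(Phase, ℝ) →ₗ[ℝ] 𝓢(Phase, ℝ) :=
  firstOrderOp (-(Pi.single j 1, 0)) fun p => pd j W p.1 / 2

/-- `b_k` as an operator on Schwartz functions. -/
noncomputable def schwartzB (k : Fin d) : 𝓢(Phase, ℝ) →ₗ[ℝ] 𝓢(Phase, ℝ) :=
  firstOrderOp (0, Pi.single k 1) fun p => p.2 k / 2

/-- `b_k*` as an operator on Schwartz functions. -/
noncomputable def schwartzBStar (k : Fin d) : 𝓢(Phase, ℝ) →ₗ[ℝ] 𝓢(Phase, ℝ) :=
  firstOrderOp (-(0, Pi.single k 1)) fun p => p.2 k / 2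

/-- `Λ²` as an operator on Schwartz functions. -/
noncomputable def schwartzLam2 (W : (Fin d → ℝ) → ℝ) (f : 𝓢(Phase, ℝ)) : 𝓢(Phase, ℝ) :=
  ∑ j, schwartzAStar W j (schwartzA W j f) + ∑ l, schwartzBStar l (schwartzB l f) + f

variable {W : (Fin d → ℝ) → ℝ}

theorem coe_schwartzA (hW : (fderiv ℝ W).HasTemperateGrowth) (j : Fin d) (f : 𝓢(Phase, ℝ)) :
    ⇑(schwartzA W j f) = aOp W j f :=
  funext fun p => firstOrderOp_apply (hasTemperateGrowth_pd hW j) _ f p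

theorem coe_schwartzAStar (hW : (fderiv ℝ W).HasTemperateGrowth) (j : Fin d) (f : 𝓢(Phase, ℝ)) :
    ⇑(schwartzAStar W j f) = aStar W j f := by
  ext p
  rw [schwartzAStar, firstOrderOp_apply (hasTemperateGrowth_pd hW j), map_neg]
  rfl

theorem coe_schwartzB (k : Fin d) (f : 𝓢(Phase, ℝ)) : ⇑(schwartzB k f) = bOp k f :=
  funext fun p => firstOrderOp_apply (hasTemperateGrowth_velocity k) _ f p

theorem coe_schwartzBStar (k : Fin d) (f : 𝓢(Phase, ℝ)) : ⇑(schwartzBStar k f) = bStar k f := by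
  ext p
  rw [schwartzBStar, firstOrderOp_apply (hasTemperateGrowth_velocity k), map_neg]
  rfl

theorem coe_schwartzLam2 (hW : (fderiv ℝ W).HasTemperateGrowth) (f : 𝓢(Phase, ℝ)) :
    ⇑(schwartzLam2 W f) = Lam2 W f := by
  ext p
  simp [schwartzLam2, Lam2, coe_schwartzAStar hW, coe_schwartzA hW, coe_schwartzBStar,
    coe_schwartzB]

theorem schwartzB_schwartzA (hW : (fderiv ℝ W).HasTemperateGrowth) (j k : Fin d)
    (f : 𝓢(Phase, ℝ)) : schwartzB k (schwartzA W j f) = schwartzA W j (schwartzB k f) := by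
  ext p
  rw [schwartzB, schwartzA, firstOrderOp_commutator (hasTemperateGrowth_velocity k)
    (hasTemperateGrowth_pd hW j), fderiv_velocity, fderiv_pd (hW.1.differentiable (by simp))]
  simp

theorem schwartzB_schwartzAStar (hW : (fderiv ℝ W).HasTemperateGrowth) (j k : Fin d)
    (f : 𝓢(Phase, ℝ)) :
    schwartzB k (schwartzAStar W j f) = schwartzAStar W j (schwartzB k f) := by
  ext p
  rw [schwartzB, schwartzAStar, firstOrderOp_commutator (hasTemperateGrowth_velocity k)
    (hasTemperateGrowth_pd hW j), fderiv_velocity, fderiv_pd (hW.1.differentiable (by simp))]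
  simp

theorem schwartzB_comm (k l : Fin d) (f : 𝓢(Phase, ℝ)) :
    schwartzB k (schwartzB l f) = schwartzB l (schwartzB k f) := by
  ext p
  rw [schwartzB, schwartzB, firstOrderOp_commutator (hasTemperateGrowth_velocity k)
    (hasTemperateGrowth_velocity l), fderiv_velocity, fderiv_velocity]
  simp [Pi.single_apply, eq_comm]

theorem schwartzB_schwartzBStar (k l : Fin d) (f : 𝓢(Phase, ℝ)) :
    schwartzB k (schwartzBStar l f)
      = schwartzBStar l (schwartzB k f) + if l = k then f else 0 := by
  ext p
  rw [schwartzB, schwartzBStar, firstOrderOp_commutator (hasTemperateGrowth_velocity k)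
    (hasTemperateGrowth_velocity l), fderiv_velocity, fderiv_velocity]
  by_cases h : l = k
  · subst h
    norm_num
  · simp [h, Ne.symm h]

/-- The commutation relation `b_k Λ² = Λ² b_k + b_k`. -/
theorem schwartzB_schwartzLam2 (hW : (fderiv ℝ W).HasTemperateGrowth) (k : Fin d)
    (f : 𝓢(Phase, ℝ)) :
    schwartzB k (schwartzLam2 W f) = schwartzLam2 W (schwartzB k f) + schwartzB k f := by
  simp only [schwartzLam2, map_add, map_sum, schwartzB_schwartzAStar hW, schwartzB_schwartzA hW,
    schwartzB_schwartzBStar, schwartzB_comm k, Finset.sum_add_distrib, Finset.sum_ite_eq',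
    Finset.mem_univ, if_true]
  abel

/-- The quadratic form of `Λ²`. -/
theorem integral_schwartzLam2_mul_self (hW : (fderiv ℝ W).HasTemperateGrowth)
    (f : 𝓢(Phase, ℝ)) :
    ∫ p, schwartzLam2 W f p * f p = ∑ j, (∫ p, schwartzA W j f p * schwartzA W j f p)
      + ∑ l, (∫ p, schwartzB l f p * schwartzB l f p) + ∫ p, f p * f p := by
  have hexp : ∀ p, schwartzLam2 W f p * f p
      = ∑ j, schwartzAStar W j (schwartzA W j f) p * f p
        + ∑ l, schwartzBStar l (schwartzB l f) p * f p + f p * f p := fun p => by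
    simp [schwartzLam2, add_mul, Finset.sum_mul]
  have hA : Integrable fun p => ∑ j, schwartzAStar W j (schwartzA W j f) p * f p :=
    integrable_finsetSum _ fun _ _ => SchwartzMap.integrable_mul _ _
  have hB : Integrable fun p => ∑ l, schwartzBStar l (schwartzB l f) p * f p :=
    integrable_finsetSum _ fun _ _ => SchwartzMap.integrable_mul _ _
  simp_rw [hexp]
  rw [integral_add (hA.fun_add hB) (SchwartzMap.integrable_mul _ _), integral_add hA hB,
    integral_finsetSum _ fun _ _ => SchwartzMap.integrable_mul _ _,
    integral_finsetSum _ fun _ _ => SchwartzMap.integrable_mul _ _]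
  congr 2
  · exact Finset.sum_congr rfl fun j _ =>
      integral_firstOrderOp_neg_mul (hasTemperateGrowth_pd hW j) _ _ _
  · exact Finset.sum_congr rfl fun l _ =>
      integral_firstOrderOp_neg_mul (hasTemperateGrowth_velocity l) _ _ _

/-- `‖b_k* f‖² = ‖b_k f‖² + ‖f‖²`. -/
theorem integral_schwartzBStar_sq (k : Fin d) (f : 𝓢(Phase, ℝ)) :
    ∫ p, schwartzBStar k f p * schwartzBStar k f p
      = (∫ p, schwartzB k f p * schwartzB k f p) + ∫ p, f p * f p := by
  refine (integral_firstOrderOp_neg_sq (hasTemperateGrowth_velocity k) _ f).trans ?_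
  simp_rw [fderiv_velocity]
  simp [schwartzB]

/-- `‖a_j* f‖² ≤ ‖a_j f‖² + ‖Hess W‖_∞ ‖f‖²`. -/
theorem integral_schwartzAStar_sq_le (hW : (fderiv ℝ W).HasTemperateGrowth) {C : ℝ}
    (hC : ∀ x, ‖iteratedFDeriv ℝ 2 W x‖ ≤ C) (j : Fin d) (f : 𝓢(Phase, ℝ)) :
    ∫ p, schwartzAStar W j f p * schwartzAStar W j f p
      ≤ (∫ p, schwartzA W j f p * schwartzA W j f p) + C * ∫ p, f p * f p := by
  refine (integral_firstOrderOp_neg_sq (hasTemperateGrowth_pd hW j) _ f).trans_le ?_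
  rw [← integral_const_mul]
  refine add_le_add le_rfl (integral_mono
    (integrable_fderiv_mul_sq (hasTemperateGrowth_pd hW j) _ f)
    ((SchwartzMap.integrable_mul f f).const_mul C) fun p => ?_)
  refine mul_le_mul_of_nonneg_right ?_ (mul_self_nonneg _)
  have hop := (iteratedFDeriv ℝ 2 W p.1).le_opNorm fun _ => Pi.single j 1
  rw [iteratedFDeriv_two_apply] at hop
  simp only [Pi.norm_single, norm_one, Finset.prod_const_one, mul_one] at hop
  rw [fderiv_pd (hW.1.differentiable (by simp))]
  linarith [le_abs_self (fderiv ℝ (fderiv ℝ W) p.1 (Pi.single j 1) (Pi.single j 1)),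
    hop.trans (hC p.1), Real.norm_eq_abs
      (fderiv ℝ (fderiv ℝ W) p.1 (Pi.single j 1) (Pi.single j 1))]

/-- `‖a_j b_k w‖² + ‖b_k w‖² ≤ ‖Λ² w‖² / 4`. -/
theorem integral_schwartzA_schwartzB_sq_le (hW : (fderiv ℝ W).HasTemperateGrowth) (j k : Fin d)
    (w : 𝓢(Phase, ℝ)) :
    (∫ p, schwartzA W j (schwartzB k w) p * schwartzA W j (schwartzB k w) p)
        + ∫ p, schwartzB k w p * schwartzB k w p
      ≤ (∫ p, schwartzLam2 W w p * schwartzLam2 W w p) / 4 := by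
  set u := schwartzLam2 W w
  set f := schwartzB k w
  have hnonneg : ∀ g : 𝓢(Phase, ℝ), 0 ≤ ∫ p, g p * g p :=
    fun g => integral_nonneg fun p => mul_self_nonneg _
  have hpair : ∫ p, u p * schwartzBStar k f p
      = (∫ p, schwartzLam2 W f p * f p) + ∫ p, f p * f p := by
    rw [← integral_add (SchwartzMap.integrable_mul _ _) (SchwartzMap.integrable_mul _ _)]
    refine (integral_firstOrderOp_mul (hasTemperateGrowth_velocity k) _ u f).symm.trans ?_
    refine integral_congr_ae (.of_forall fun p => ?_)
    have hp := DFunLike.congr_fun (schwartzB_schwartzLam2 hW k w) p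
    change schwartzB k u p * f p = _
    rw [hp, _root_.add_apply, add_mul]
  have hyoung : ∫ p, u p * schwartzBStar k f p
      ≤ (∫ p, u p * u p) / 4 + ∫ p, schwartzBStar k f p * schwartzBStar k f p := by
    rw [← integral_div, ← integral_add ((SchwartzMap.integrable_mul _ _).div_const 4)
      (SchwartzMap.integrable_mul _ _)]
    refine integral_mono (SchwartzMap.integrable_mul _ _)
      (((SchwartzMap.integrable_mul _ _).div_const 4).add (SchwartzMap.integrable_mul _ _))
      fun p => ?_
    beta_reduce
    nlinarith [sq_nonneg (u p / 2 - schwartzBStar k f p)]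
  have hA := Finset.single_le_sum (fun i _ => hnonneg (schwartzA W i f)) (Finset.mem_univ j)
  have hB := Finset.single_le_sum (fun l _ => hnonneg (schwartzB l f)) (Finset.mem_univ k)
  rw [hpair, integral_schwartzLam2_mul_self hW, integral_schwartzBStar_sq] at hyoung
  linarith

end PhaseSpace

/-- For Schwartz `w` with `Λ² w = u` (so `w = Λ⁻² u`), one has
`‖a_j* b_k Λ⁻² u‖² ≤ (‖Hess W‖_∞ + 2) ‖u‖²`. -/
theorem stmt_13 {d : ℕ} (W : (Fin d → ℝ) → ℝ) (hW : ContDiff ℝ (⊤ : ℕ∞) W)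
    (hbd : ∀ n : ℕ, 2 ≤ n → ∃ C : ℝ, ∀ x, ‖iteratedFDeriv ℝ n W x‖ ≤ C)
    (C : ℝ) (hC : ∀ x, ‖iteratedFDeriv ℝ 2 W x‖ ≤ C)
    (w : SchwartzMap ((Fin d → ℝ) × (Fin d → ℝ)) ℝ)
    (u : (Fin d → ℝ) × (Fin d → ℝ) → ℝ) (hu : u = Lam2 W ⇑w) (j k : Fin d) :
    (eLpNorm (aStar W j (bOp k ⇑w)) 2 volume) ^ 2
      ≤ ENNReal.ofReal (C + 2) * (eLpNorm u 2 volume) ^ 2 := by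
  have hT : (fderiv ℝ W).HasTemperateGrowth := hasTemperateGrowth_fderiv_of_bounded hW hbd
  have hC0 : 0 ≤ C := (norm_nonneg _).trans (hC 0)
  rw [hu, ← coe_schwartzLam2 hT, ← coe_schwartzB, ← coe_schwartzAStar hT,
    SchwartzMap.eLpNorm_two_sq, SchwartzMap.eLpNorm_two_sq,
    ← ENNReal.ofReal_mul (by positivity)]
  refine ENNReal.ofReal_le_ofReal ?_
  have hstar := integral_schwartzAStar_sq_le hT hC j (schwartzB k w)
  have hmain := integral_schwartzA_schwartzB_sq_le hT j k w
  have hA : 0 ≤ ∫ p, schwartzA W j (schwartzB k w) p * schwartzA W j (schwartzB k w) p :=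
    integral_nonneg fun p => mul_self_nonneg _
  have hB : 0 ≤ ∫ p, schwartzB k w p * schwartzB k w p :=
    integral_nonneg fun p => mul_self_nonneg _
  nlinarith [mul_nonneg hC0 hA]
end
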